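/- Let L be a non-contractible compact metric ANR. If X is a separable metric space with L-Ind X = n ∈ ℕ, then the set K(X) = { b ∈ X : L-Ind_{b+} X = n } is non-empty, and L-Ind_{b+} K(X) = n for each b ∈ K(X). -/

import Mathlib

open Set Topology Cardinal

noncomputable section

attribute [local instance] Classical.propDecidable

/-- Values of dimension functions: `⊥ : WithBot Ordinal.{0}` encodes `−1`,
ordinals are the usual values, and `⊤` encodes `∞`. -/
abbrev Dim : Type 1 := WithTop (WithBot Ordinal.{0})

/-- An ordinal viewed as a dimension value. -/
def Dim.ofOrdinal (a : Ordinal.{0}) : Dim := ((a : WithBot Ordinal.{0}) : Dim)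

/-- The dimension value `−1`. -/
def Dim.minusOne : Dim := ((⊥ : WithBot Ordinal.{0}) : Dim)

/-- An integer `m ≥ −1` viewed as a dimension value. -/
def Dim.ofInt (m : ℤ) : Dim := if 0 ≤ m then Dim.ofOrdinal m.toNat else Dim.minusOne

/-- `A` is a `K`-tuple for the simplicial complex `K` on the vertex set `Fin m`:
whenever the members indexed by a nonempty `I` have a common point, `I` spans a
simplex of `K`. -/
def IsKTuple {m : ℕ} (K : Finset (Fin m) → Prop) {X : Type} (A : Fin m → Set X) : Prop :=
  ∀ I : Finset (Fin m), I.Nonempty → (⋂ i ∈ I, A i).Nonempty → K I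

/-- `K` is an abstract (finite) simplicial complex with vertex set `Fin m`:
it is closed under passing to nonempty subsets, and contains every vertex. -/
def IsComplex {m : ℕ} (K : Finset (Fin m) → Prop) : Prop :=
  (∀ s t : Finset (Fin m), s ⊆ t → s.Nonempty → K t → K s) ∧ ∀ i, K {i}

/-- The boundary complex `∂Δ^k` of the `k`-simplex: all proper subsets of the
`k+1` vertices span simplices. -/
def bComplex (k : ℕ) : Finset (Fin (k + 1)) → Prop := fun s => s ≠ Finset.univ

/-- `U` is an (open) `K`-neighbourhood of the tuple `F`. -/
def KNbhd {m : ℕ} (K : Finset (Fin m) → Prop) {X : Type} [TopologicalSpace X]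
    (F U : Fin m → Set X) : Prop :=
  (∀ i, IsOpen (U i)) ∧ IsKTuple K U ∧ ∀ i, F i ⊆ U i

/-- Auxiliary form of `K-Ind X ≤ α`, defined by transfinite recursion on `α`:
every closed `K`-tuple has a `K`-neighbourhood whose corresponding `K`-partition
is either empty (dimension `−1`) or has `K-Ind < α`. -/
def KIndLeAux {m : ℕ} (K : Finset (Fin m) → Prop) :
    Ordinal.{0} → ∀ X : Type, TopologicalSpace X → Prop :=
  (wellFounded_lt (α := Ordinal.{0})).fix fun α rec X tX =>
    letI := tX
    ∀ F : Fin m → Set X, (∀ i, IsClosed (F i)) → IsKTuple K F →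
      ∃ U : Fin m → Set X, (∀ i, IsOpen (U i)) ∧ IsKTuple K U ∧ (∀ i, F i ⊆ U i) ∧
        ((⋃ i, U i)ᶜ = (∅ : Set X) ∨
          ∃ β : Set.Iio α, rec β.1 β.2 (↥((⋃ i, U i)ᶜ)) inferInstance)

/-- `K-Ind X ≤ α` (for an ordinal `α ≥ 0`). -/
def KIndLE {m : ℕ} (K : Finset (Fin m) → Prop) (X : Type) [tX : TopologicalSpace X]
    (α : Ordinal.{0}) : Prop :=
  KIndLeAux K α X tX

/-- Fedorchuk's inductive dimension `K-Ind` modulo a simplicial complex `K`;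
`−1` for the empty space, the least `α` with `K-Ind X ≤ α` otherwise, `∞` if none. -/
def KInd {m : ℕ} (K : Finset (Fin m) → Prop) (X : Type) [TopologicalSpace X] : Dim :=
  if IsEmpty X then Dim.minusOne
  else if ∃ α, KIndLE K X α then Dim.ofOrdinal (sInf {α | KIndLE K X α}) else ⊤

/-- The set of `K`-obstruction points of an open `K`-tuple `U`: points covered
by no `K`-neighbourhood of `U`. -/
def KObs {m : ℕ} (K : Finset (Fin m) → Prop) {X : Type} [TopologicalSpace X]
    (U : Fin m → Set X) : Set X :=
  {x | ¬ ∃ V : Fin m → Set X, KNbhd K U V ∧ x ∈ ⋃ i, V i}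

/-- `X` is strongly `α`-dimensional: `K-Ind X` is a positive ordinal `α` and some
closed `K`-tuple admits no `K`-neighbourhood `U` without obstruction points whose
corresponding `K`-partition has `K-Ind < α`. -/
def KStrongly {m : ℕ} (K : Finset (Fin m) → Prop) (X : Type) [TopologicalSpace X] : Prop :=
  (∃ α : Ordinal.{0}, 0 < α ∧ KInd K X = Dim.ofOrdinal α) ∧
  ∃ F : Fin m → Set X, (∀ i, IsClosed (F i)) ∧ IsKTuple K F ∧
    ∀ U : Fin m → Set X, KNbhd K F U →
      KInd K (↥((⋃ i, U i)ᶜ)) < KInd K X → KObs K U ≠ ∅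

/-- The dimensional strength degree `K-str X ∈ {0,1}`. -/
def KStr {m : ℕ} (K : Finset (Fin m) → Prop) (X : Type) [TopologicalSpace X] : ℕ :=
  if KStrongly K X then 1 else 0

/-- `K-dim X ≤ n`: any `n+1` closed `K`-tuples admit `K`-partitions with empty
intersection. -/
def KDimLE {m : ℕ} (K : Finset (Fin m) → Prop) (X : Type) [TopologicalSpace X] (n : ℕ) : Prop :=
  ∀ F : Fin (n + 1) → Fin m → Set X,
    (∀ j i, IsClosed (F j i)) → (∀ j, IsKTuple K (F j)) →
    ∃ U : Fin (n + 1) → Fin m → Set X, (∀ j, KNbhd K (F j) (U j)) ∧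
      (⋂ j, (⋃ i, U j i)ᶜ) = (∅ : Set X)

/-- Fedorchuk's dimension `K-dim` modulo a simplicial complex `K`. -/
def KDim {m : ℕ} (K : Finset (Fin m) → Prop) (X : Type) [TopologicalSpace X] : Dim :=
  if IsEmpty X then Dim.minusOne
  else if ∃ n, KDimLE K X n then Dim.ofOrdinal ((sInf {n | KDimLE K X n} : ℕ) : Ordinal.{0}) else ⊤

/-- `dim X ≤ n` for the Lebesgue covering dimension: every finite open cover has
an open shrinking of order at most `n+1`. -/
def CovDimLE (X : Type) [TopologicalSpace X] (n : ℕ) : Prop :=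
  ∀ (ι : Type), Finite ι → ∀ U : ι → Set X, (∀ i, IsOpen (U i)) → (⋃ i, U i) = Set.univ →
    ∃ V : ι → Set X, (∀ i, IsOpen (V i)) ∧ (∀ i, V i ⊆ U i) ∧ (⋃ i, V i) = Set.univ ∧
      ∀ x : X, ({i | x ∈ V i}).ncard ≤ n + 1

/-- The Lebesgue covering dimension. -/
def covDim (X : Type) [TopologicalSpace X] : Dim :=
  if IsEmpty X then Dim.minusOne
  else if ∃ n, CovDimLE X n then Dim.ofOrdinal ((sInf {n | CovDimLE X n} : ℕ) : Ordinal.{0}) else ⊤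

/-- `Ind X ≤ n` for the large inductive dimension, by recursion on `n`. -/
def IndLE : ℕ → ∀ X : Type, TopologicalSpace X → Prop
  | 0, X, tX =>
    letI := tX
    ∀ F U : Set X, IsClosed F → IsOpen U → F ⊆ U →
      ∃ V : Set X, IsOpen V ∧ F ⊆ V ∧ V ⊆ U ∧ frontier V = ∅
  | n + 1, X, tX =>
    letI := tX
    ∀ F U : Set X, IsClosed F → IsOpen U → F ⊆ U →
      ∃ V : Set X, IsOpen V ∧ F ⊆ V ∧ V ⊆ U ∧ IndLE n (↥(frontier V)) inferInstance

/-- The large inductive dimension `Ind`. -/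
def IndDim (X : Type) [tX : TopologicalSpace X] : Dim :=
  if IsEmpty X then Dim.minusOne
  else if ∃ n, IndLE n X tX then Dim.ofOrdinal ((sInf {n | IndLE n X tX} : ℕ) : Ordinal.{0}) else ⊤

/-- The relation generating the topological join `A ∗ B`: the copy of `B` is
collapsed at parameter `0`, the copy of `A` at parameter `1`. -/
def JoinRel (A B : Type) : (A × B × unitInterval) → (A × B × unitInterval) → Prop :=
  fun p q => (p.2.2 = 0 ∧ q.2.2 = 0 ∧ p.1 = q.1) ∨ (p.2.2 = 1 ∧ q.2.2 = 1 ∧ p.2.1 = q.2.1)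

/-- The topological join `A ∗ B`. -/
abbrev Join (A B : Type) [TopologicalSpace A] [TopologicalSpace B] : Type :=
  Quot (JoinRel A B)

/-- Auxiliary construction of the join of `n+1` copies of `L`, bundled with its
topology. -/
def JoinPowAux (L : Type) (tL : TopologicalSpace L) : ℕ → (T : Type) × TopologicalSpace T
  | 0 => ⟨L, tL⟩
  | n + 1 =>
    let p := JoinPowAux L tL n
    letI := tL
    letI := p.2
    ⟨Join L p.1, inferInstance⟩

/-- The join `L ∗ ⋯ ∗ L` of `n+1` copies of `L`. -/
def JoinPow (L : Type) [tL : TopologicalSpace L] (n : ℕ) : Type :=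
  (JoinPowAux L tL n).1

instance joinPowTopologicalSpace (L : Type) [tL : TopologicalSpace L] (n : ℕ) :
    TopologicalSpace (JoinPow L n) :=
  (JoinPowAux L tL n).2

/-- `L-dim X ≤ n`: every continuous map from a closed subset of `X` to the join
of `n+1` copies of `L` extends continuously over `X`. -/
def LDimLE (L : Type) [TopologicalSpace L] (X : Type) [TopologicalSpace X] (n : ℕ) : Prop :=
  ∀ F : Set X, IsClosed F → ∀ f : C(F, JoinPow L n),
    ∃ g : C(X, JoinPow L n), ∀ x : F, g x = f x

/-- Fedorchuk's dimension `L-dim` modulo an ANR `L`. -/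
def LDim (L : Type) [TopologicalSpace L] (X : Type) [TopologicalSpace X] : Dim :=
  if IsEmpty X then Dim.minusOne
  else if ∃ n, LDimLE L X n then Dim.ofOrdinal ((sInf {n | LDimLE L X n} : ℕ) : Ordinal.{0}) else ⊤

/-- Auxiliary form of `L-Ind X ≤ α`, by transfinite recursion on `α`: every map
to `L` from a closed subset of `X` has an `L`-partition which is either empty or
has `L-Ind < α`. -/
def LIndLeAux (L : Type) [TopologicalSpace L] :
    Ordinal.{0} → ∀ X : Type, TopologicalSpace X → Prop :=
  (wellFounded_lt (α := Ordinal.{0})).fix fun α rec X tX =>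
    letI := tX
    ∀ F : Set X, IsClosed F → ∀ f : C(F, L),
      ∃ U : Set X, IsOpen U ∧ ∃ hFU : F ⊆ U,
        (∃ g : C(U, L), ∀ (x : X) (hx : x ∈ F), g ⟨x, hFU hx⟩ = f ⟨x, hx⟩) ∧
        (Uᶜ = (∅ : Set X) ∨ ∃ β : Set.Iio α, rec β.1 β.2 (↥(Uᶜ)) inferInstance)

/-- `L-Ind X ≤ α` (for an ordinal `α ≥ 0`). -/
def LIndLE (L : Type) [TopologicalSpace L] (X : Type) [tX : TopologicalSpace X]
    (α : Ordinal.{0}) : Prop :=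
  LIndLeAux L α X tX

/-- Fedorchuk's inductive dimension `L-Ind` modulo an ANR `L`. -/
def LInd (L : Type) [TopologicalSpace L] (X : Type) [TopologicalSpace X] : Dim :=
  if IsEmpty X then Dim.minusOne
  else if ∃ α, LIndLE L X α then Dim.ofOrdinal (sInf {α | LIndLE L X α}) else ⊤

/-- `L` is an absolute neighbourhood retract (for metric spaces): `L` is
metrizable and whenever a closed subset `A` of a metric space is homeomorphic to
`L` via `e`, the map `e` extends continuously over a neighbourhood of `A`. -/
def IsANR (L : Type) [TopologicalSpace L] : Prop :=
  TopologicalSpace.MetrizableSpace L ∧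
  ∀ (M : Type) [MetricSpace M], ∀ A : Set M, IsClosed A → ∀ e : A ≃ₜ L,
    ∃ U : Set M, IsOpen U ∧ ∃ hAU : A ⊆ U, ∃ r : C(U, L),
      ∀ (a : M) (ha : a ∈ A), r ⟨a, hAU ha⟩ = e ⟨a, ha⟩

/-- `L-Ind_{b+} X`: the least dimension value `d` such that some open
neighbourhood of `b` has closure of `L-Ind` at most `d`. -/
def LIndPlus (L : Type) [TopologicalSpace L] {X : Type} [TopologicalSpace X] (b : X) : Dim :=
  sInf {d : Dim | ∃ U : Set X, IsOpen U ∧ b ∈ U ∧ LInd L (↥(closure U)) ≤ d}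

/-- The set `K(X) = {b ∈ X : L-Ind_{b+} X = L-Ind X}`. -/
def LKset (L : Type) [TopologicalSpace L] (X : Type) [TopologicalSpace X] : Set X :=
  {b | LIndPlus L b = LInd L X}

/-- The weight of a topological space: the least cardinality of a basis. -/
def tWeight (X : Type) [TopologicalSpace X] : Cardinal :=
  sInf {c | ∃ B : Set (Set X), TopologicalSpace.IsTopologicalBasis B ∧ #B = c}

/-- The family `𝒮_X` of all subsets of `X` that are finite or homeomorphic to the
one-point compactification `A_{ℵ₀}` of a countably infinite discrete space. -/
def SFam (X : Type) [TopologicalSpace X] : Set (Set X) :=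
  {S | S.Finite ∨ Nonempty (↥S ≃ₜ OnePoint ℕ)}

/-- The relation generating the quotient `N` in the `Z(X,Y)` construction:
each set `{μ} × {x} × Y` is collapsed to a point. -/
def ZRel (ι X Y : Type) : (OnePoint ι × X × Y) → (OnePoint ι × X × Y) → Prop :=
  fun p q => p.1 = OnePoint.infty ∧ q.1 = OnePoint.infty ∧ p.2.1 = q.2.1

/-- The quotient space `N` of `A_𝔪 × X × Y`. -/
abbrev ZQuot (ι X Y : Type) [TopologicalSpace ι] [TopologicalSpace X] [TopologicalSpace Y] :
    Type :=
  Quot (ZRel ι X Y)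

/-- The subset `Z(X,Y) = ⋃_{α ∈ A_𝔪} H(α)` of `N`:  `H(μ) = π₁({μ} × X × Y)` and
`H(α) = π₁({α} × φ(α) × Y)` for `α ≠ μ`. -/
def ZSet (ι X Y : Type) [TopologicalSpace ι] [TopologicalSpace X] [TopologicalSpace Y]
    (φ : ι → Set X) : Set (ZQuot ι X Y) :=
  {z | ∃ p : OnePoint ι × X × Y, Quot.mk (ZRel ι X Y) p = z ∧
        (p.1 = OnePoint.infty ∨ ∃ i : ι, p.1 = (i : OnePoint ι) ∧ p.2.1 ∈ φ i)}

/-- The space `Z(X,Y)` (for the data `ι`, `φ`), with the subspace topology. -/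
abbrev ZSpace (ι X Y : Type) [TopologicalSpace ι] [TopologicalSpace X] [TopologicalSpace Y]
    (φ : ι → Set X) : Type :=
  ↥(ZSet ι X Y φ)

/-- The subset `H(μ)` of `Z(X,Y)`. -/
def ZHmu (ι X Y : Type) [TopologicalSpace ι] [TopologicalSpace X] [TopologicalSpace Y]
    (φ : ι → Set X) : Set (ZSpace ι X Y φ) :=
  {z | ∃ (x : X) (y : Y), (z : ZQuot ι X Y) = Quot.mk (ZRel ι X Y) (OnePoint.infty, x, y)}

/-- The projection `π_X : N → X`, `π₁(α,x,y) ↦ x`. -/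
def ZQuotProjX {ι X Y : Type} [TopologicalSpace ι] [TopologicalSpace X] [TopologicalSpace Y] :
    ZQuot ι X Y → X :=
  Quot.lift (fun p => p.2.1) (fun _ _ h => h.2.2)

/-- The projection `π_X : Z(X,Y) → X`. -/
def ZProjX {ι X Y : Type} [TopologicalSpace ι] [TopologicalSpace X] [TopologicalSpace Y]
    (φ : ι → Set X) : ZSpace ι X Y φ → X :=
  fun z => ZQuotProjX (z : ZQuot ι X Y)

/-- The cardinality requirements on the index set `ι` (of cardinality `𝔪`) in the
`Z(X,Y)` construction: `𝔪 ≥ max {ℵ₀, (wX)⁺, (wY)⁺, card 𝒮_X}`. -/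
def ZCardOK (X Y ι : Type) [TopologicalSpace X] [TopologicalSpace Y] : Prop :=
  ℵ₀ ≤ #ι ∧ tWeight X < #ι ∧ tWeight Y < #ι ∧ #(SFam X) ≤ #ι

/-- The requirements on `φ : A_𝔪 \ {μ} → 𝒮_X`: it takes values in `𝒮_X` and every
fibre has cardinality `𝔪`. -/
def ZPhiOK {X ι : Type} [TopologicalSpace X] (φ : ι → Set X) : Prop :=
  (∀ i, φ i ∈ SFam X) ∧ ∀ S ∈ SFam X, #(↥(φ ⁻¹' {S})) = #ι



namespace LDimProof

/-- A compact ambient absolute extensor for `L`, with a neighbourhood retraction. -/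
structure Amb (L Q : Type) [MetricSpace L] [MetricSpace Q] where
  e : L → Q
  cont_e : Continuous e
  W : Set Q
  openW : IsOpen W
  r : Q → L
  cont_r : ContinuousOn r W
  e_mem : ∀ x, e x ∈ W
  r_e : ∀ x, r (e x) = x
  comb : unitInterval → Q → Q → Q
  cont_comb : Continuous fun p : unitInterval × Q × Q => comb p.1 p.2.1 p.2.2
  comb_zero : ∀ a b, comb 0 a b = b
  comb_one : ∀ a b, comb 1 a b = a
  dist_comb : ∀ t a b, dist (comb t a b) b ≤ dist a b
  tietze : ∀ (X : Type) [MetricSpace X] (F : Set X) (f : X → Q), IsClosed F → ContinuousOn f F →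
    ∃ g : C(X, Q), EqOn g f F
  embeds : ∀ (X : Type) [MetricSpace X] [TopologicalSpace.SeparableSpace X],
    ∃ j : X → Q, IsEmbedding j

/-- Neighbourhood retraction from the ANR hypothesis, for a closed embedding. -/
theorem anr_retract {L : Type} [MetricSpace L] [Nonempty L] (hANR : IsANR L)
    {M : Type} [MetricSpace M] (j : L → M) (hj : IsClosedEmbedding j) :
    ∃ (W : Set M) (r : M → L), IsOpen W ∧ ContinuousOn r W ∧ (∀ x, j x ∈ W) ∧
      ∀ x, r (j x) = x := by
  classical
  let e : L ≃ₜ range j := hj.isEmbedding.toHomeomorph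
  obtain ⟨U, hU, hAU, r, hr⟩ := hANR.2 M (range j) hj.isClosed_range e.symm
  refine ⟨U, fun x => if h : x ∈ U then r ⟨x, h⟩ else Classical.arbitrary L, hU, ?_, ?_, ?_⟩
  · rw [continuousOn_iff_continuous_domRestrict]
    convert r.continuous using 1
    funext x
    simp [Set.domRestrict]
  · intro x; exact hAU ⟨x, rfl⟩
  · intro x
    have hx : j x ∈ U := hAU ⟨x, rfl⟩
    simp only [hx, dif_pos]
    rw [hr (j x) ⟨x, rfl⟩]
    exact e.symm_apply_apply x

/-- convex combination in the unit interval -/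
def icomb (t a b : unitInterval) : unitInterval :=
  ⟨(t : ℝ) * a + (1 - t) * b, by
    have h1 := t.2.1; have h2 := t.2.2; have h3 := a.2.1; have h4 := a.2.2
    have h5 := b.2.1; have h6 := b.2.2
    constructor
    · have : 0 ≤ (1 - (t : ℝ)) := by linarith
      positivity
    · nlinarith⟩

theorem icomb_dist (t a b : unitInterval) : dist (icomb t a b) b ≤ dist a b := by
  rw [Subtype.dist_eq, Subtype.dist_eq, Real.dist_eq, Real.dist_eq]
  have : ((icomb t a b : unitInterval) : ℝ) - b = t * ((a : ℝ) - b) := by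
    simp only [icomb]; ring
  rw [this, abs_mul, abs_of_nonneg t.2.1]
  have h2 := t.2.2
  nlinarith [abs_nonneg ((a : ℝ) - b)]

theorem tietze_on {Q : Type} [TopologicalSpace Q] [TietzeExtension.{0, 0} Q] (X : Type)
    [TopologicalSpace X] [NormalSpace X] (F : Set X) (f : X → Q) (hF : IsClosed F)
    (hf : ContinuousOn f F) : ∃ g : C(X, Q), EqOn g f F := by
  obtain ⟨g, hg⟩ := ContinuousMap.exists_restrict_eq hF
    (⟨F.domRestrict f, continuousOn_iff_continuous_domRestrict.1 hf⟩ : C(F, Q))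
  refine ⟨g, fun x hx => ?_⟩
  have := congrArg (fun k : C(F, Q) => k ⟨x, hx⟩) hg
  exact this

theorem exists_amb (L : Type) [MetricSpace L] [CompactSpace L] [Nonempty L] (hANR : IsANR L) :
    ∃ (Q : Type) (mQ : MetricSpace Q) (_ : CompactSpace Q), Nonempty (Amb L Q) := by
  let mQ : MetricSpace (ℕ → unitInterval) := PiCountable.metricSpace
  obtain ⟨j, hj⟩ := Metric.PiNatEmbed.exists_embedding_to_hilbert_cube (X := L)
  have hjc : IsClosedEmbedding j := hj.continuous.isClosedEmbedding hj.injective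
  obtain ⟨W, r, hW, hr, hjW, hrj⟩ := anr_retract hANR j hjc
  have hT : TietzeExtension.{0, 0} unitInterval := inferInstance
  refine ⟨ℕ → unitInterval, mQ, inferInstance, ⟨?_⟩⟩
  refine { e := j, cont_e := hj.continuous, W := W, openW := hW, r := r, cont_r := hr,
           e_mem := hjW, r_e := hrj, comb := fun t a b n => icomb t (a n) (b n), cont_comb := ?_, comb_zero := ?_, comb_one := ?_, dist_comb := ?_, tietze := ?_, embeds := ?_ }
  · refine continuous_pi fun n => ?_
    unfold icomb
    fun_prop
  · intro a b; funext n; apply Subtype.ext; simp [icomb]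
  · intro a b; funext n; apply Subtype.ext; simp [icomb]
  · intro t a b
    change dist _ _ ≤ dist _ _
    rw [PiCountable.dist_eq_tsum, PiCountable.dist_eq_tsum]
    refine (PiCountable.dist_summable _ _).tsum_le_tsum (fun i => ?_) (PiCountable.dist_summable _ _)
    exact min_le_min le_rfl (icomb_dist _ _ _)
  · intro X _ F f hF hf
    exact tietze_on X F f hF hf
  · intro X _ _
    exact Metric.PiNatEmbed.exists_embedding_to_hilbert_cube (X := X)


/-- `L-dim X < k` in the partition form: any `k` maps from closed sets to `L` extend over open
sets covering `X`. -/
def D (L : Type) [TopologicalSpace L] (k : ℕ) (X : Type) [TopologicalSpace X] : Prop :=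
  ∀ (F : Fin k → Set X) (f : Fin k → X → L), (∀ i, IsClosed (F i)) →
    (∀ i, ContinuousOn (f i) (F i)) →
    ∃ (U : Fin k → Set X) (g : Fin k → X → L), (∀ i, IsOpen (U i)) ∧ (∀ i, F i ⊆ U i) ∧
      (∀ i, ContinuousOn (g i) (U i)) ∧ (∀ i, EqOn (g i) (f i) (F i)) ∧ (⋃ i, U i) = Set.univ

theorem exists_seq_of_step {α : Type*} (R : ℕ → α → α → Prop) (h : ∀ j a, ∃ b, R j a b) (a₀ : α) :
    ∃ s : ℕ → α, s 0 = a₀ ∧ ∀ j, R j (s j) (s (j + 1)) := by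
  choose n hn using h
  exact ⟨fun j => Nat.rec a₀ (fun j a => n j a) j, rfl, fun j => hn j _⟩

section basics

variable {L Q : Type} [MetricSpace L] [MetricSpace Q]

theorem shrink {X : Type} [TopologicalSpace X] [NormalSpace X] {k : ℕ} (F U : Fin k → Set X)
    (hF : ∀ i, IsClosed (F i)) (hU : ∀ i, IsOpen (U i)) (hFU : ∀ i, F i ⊆ U i)
    (hcov : (⋃ i, U i) = Set.univ) :
    ∃ C : Fin k → Set X, (∀ i, IsClosed (C i)) ∧ (∀ i, F i ⊆ interior (C i)) ∧
      (∀ i, C i ⊆ U i) ∧ (⋃ i, interior (C i)) = Set.univ := by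
  obtain ⟨V, hVc, hVo, hV⟩ := exists_iUnion_eq_closure_subset hU (fun x => Set.toFinite _) hcov
  have h2 : ∀ i, ∃ V', IsOpen V' ∧ F i ⊆ V' ∧ closure V' ⊆ U i := fun i =>
    normal_exists_closure_subset (hF i) (hU i) (hFU i)
  choose V' hV'o hFV' hV' using h2
  have hsub : ∀ i, V i ∪ V' i ⊆ interior (closure (V i ∪ V' i)) := fun i =>
    interior_maximal subset_closure ((hVo i).union (hV'o i))
  refine ⟨fun i => closure (V i ∪ V' i), fun i => isClosed_closure, fun i => ?_, fun i => ?_, ?_⟩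
  · exact ((hFV' i).trans subset_union_right).trans (hsub i)
  · show closure (V i ∪ V' i) ⊆ U i
    rw [closure_union]; exact union_subset (hV i) (hV' i)
  · rw [eq_univ_iff_forall] at hVc ⊢
    intro x
    obtain ⟨i, hi⟩ := mem_iUnion.1 (hVc x)
    exact mem_iUnion.2 ⟨i, hsub i (Or.inl hi)⟩

theorem ane (a : Amb L Q) {X : Type} [MetricSpace X] (F : Set X) (f : X → L) (hF : IsClosed F)
    (hf : ContinuousOn f F) :
    ∃ (C : Set X) (g : X → L), IsClosed C ∧ F ⊆ interior C ∧ ContinuousOn g C ∧ EqOn g f F := by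
  obtain ⟨H, hH⟩ := a.tietze X F (fun x => a.e (f x)) hF (a.cont_e.comp_continuousOn hf)
  have hU : IsOpen (H ⁻¹' a.W) := a.openW.preimage H.continuous
  have hFU : F ⊆ H ⁻¹' a.W := fun x hx => by
    rw [mem_preimage, hH hx]; exact a.e_mem _
  obtain ⟨V, hV, hFV, hVU⟩ := normal_exists_closure_subset hF hU hFU
  refine ⟨closure V, fun x => a.r (H x), isClosed_closure,
    hFV.trans (interior_maximal subset_closure hV), ?_, ?_⟩
  · exact a.cont_r.comp H.continuous.continuousOn (fun x hx => hVU hx)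
  · intro x hx
    simp only [hH hx, a.r_e]

theorem stepS [Nonempty L] (a : Amb L Q) {X : Type} [MetricSpace X] {k : ℕ} (S : Set X)
    (hS : IsClosed S) (hD : D L k S) (F : Fin k → Set X) (f : Fin k → X → L)
    (hF : ∀ i, IsClosed (F i)) (hf : ∀ i, ContinuousOn (f i) (F i)) :
    ∃ (C : Fin k → Set X) (g : Fin k → X → L), (∀ i, IsClosed (C i)) ∧
      (∀ i, F i ⊆ interior (C i)) ∧ (∀ i, ContinuousOn (g i) (C i)) ∧
      (∀ i, EqOn (g i) (f i) (F i)) ∧ S ⊆ ⋃ i, interior (C i) := by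
  obtain ⟨U, g, hU, hFU, hg, hgf, hcov⟩ := hD (fun i => Subtype.val ⁻¹' F i)
    (fun i x => f i x) (fun i => (hF i).preimage continuous_subtype_val)
    (fun i => (hf i).comp continuous_subtype_val.continuousOn (fun x hx => hx))
  obtain ⟨C, hC, hFC, hCU, hCcov⟩ := shrink _ U
    (fun i => (hF i).preimage continuous_subtype_val) hU hFU hcov
  -- glue
  have key : ∀ i, ∃ (C' : Set X) (g' : X → L), IsClosed C' ∧
      F i ∪ (Subtype.val '' C i) ⊆ interior C' ∧ ContinuousOn g' C' ∧ EqOn g' (f i) (F i) := by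
    intro i
    have hcl : IsClosed (Subtype.val '' C i : Set X) :=
      hS.isClosedEmbedding_subtypeVal.isClosedMap _ (hC i)
    let h : X → L := fun x => if x ∈ F i then f i x else
      if hx : x ∈ S then g i ⟨x, hx⟩ else Classical.arbitrary L
    have h1 : EqOn h (f i) (F i) := fun x hx => by simp [h, hx]
    have h2 : ∀ x ∈ C i, h x = g i x := by
      intro x hx
      by_cases hxF : (x : X) ∈ F i
      · rw [h1 hxF]; exact (hgf i hxF).symm
      · simp [h, hxF]
    have hc : ContinuousOn h (F i ∪ (Subtype.val '' C i)) := by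
      refine ContinuousOn.union_of_isClosed ((hf i).congr h1) ?_ (hF i) hcl
      rw [hS.isClosedEmbedding_subtypeVal.isEmbedding.isInducing.continuousOn_image_iff]
      exact ((hg i).mono (hCU i)).congr h2
    obtain ⟨C', g', hC', hsub, hg', he⟩ := ane a _ h ((hF i).union hcl) hc
    exact ⟨C', g', hC', hsub, hg', fun x hx => (he (Or.inl hx)).trans (h1 hx)⟩
  choose C' g' hC' hsub hg' he using key
  refine ⟨C', g', hC', fun i => subset_union_left.trans (hsub i), hg', he, ?_⟩
  intro x hx
  obtain ⟨i, hi⟩ := mem_iUnion.1 (eq_univ_iff_forall.1 hCcov ⟨x, hx⟩)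
  exact mem_iUnion.2 ⟨i, hsub i (Or.inr ⟨_, interior_subset hi, rfl⟩)⟩

theorem limit_map [Nonempty L] {X : Type} [TopologicalSpace X] (C : ℕ → Set X) (g : ℕ → X → L)
    (hC : ∀ j, C j ⊆ interior (C (j + 1))) (hg : ∀ j, ContinuousOn (g j) (C j))
    (hgg : ∀ j, EqOn (g (j + 1)) (g j) (C j)) :
    IsOpen (⋃ j, C j) ∧ ∃ G : X → L, ContinuousOn G (⋃ j, C j) ∧ ∀ j, EqOn G (g j) (C j) := by
  have hmono : Monotone C := monotone_nat_of_le_succ fun j => (hC j).trans interior_subset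
  have hEq : ∀ j k, j ≤ k → EqOn (g k) (g j) (C j) := by
    intro j k hjk
    induction k, hjk using Nat.le_induction with
    | base => exact fun x _ => rfl
    | succ k hjk ih => exact fun x hx => (hgg k (hmono hjk hx)).trans (ih hx)
  let G : X → L := fun x => if h : ∃ j, x ∈ C j then g (Nat.find h) x else Classical.arbitrary L
  have hG : ∀ j, EqOn G (g j) (C j) := by
    intro j x hx
    have h : ∃ j, x ∈ C j := ⟨j, hx⟩
    have : G x = g (Nat.find h) x := by simp [G, h]
    rw [this]
    exact (hEq _ j (Nat.find_min' h hx) (Nat.find_spec h)).symm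
  refine ⟨?_, G, ?_, hG⟩
  · rw [isOpen_iff_mem_nhds]
    intro x hx
    obtain ⟨j, hj⟩ := mem_iUnion.1 hx
    exact Filter.mem_of_superset (mem_interior_iff_mem_nhds.1 (hC j hj)) (subset_iUnion C (j + 1))
  · intro x hx
    obtain ⟨j, hj⟩ := mem_iUnion.1 hx
    have hn := mem_interior_iff_mem_nhds.1 (hC j hj)
    exact (((hg (j + 1)).congr (hG (j + 1))).continuousAt hn).continuousWithinAt

theorem sum_thm [Nonempty L] (a : Amb L Q) {X : Type} [MetricSpace X] {k : ℕ} (A : ℕ → Set X)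
    (hA : ∀ j, IsClosed (A j)) (hD : ∀ j, D L k (A j)) (hcov : (⋃ j, A j) = Set.univ) : D L k X := by
  intro F f hF hf
  let St := {p : (Fin k → Set X) × (Fin k → X → L) //
    (∀ i, IsClosed (p.1 i)) ∧ ∀ i, ContinuousOn (p.2 i) (p.1 i)}
  obtain ⟨s, hs0, hs⟩ := exists_seq_of_step
    (fun (j : ℕ) (p q : St) => (∀ i, p.1.1 i ⊆ interior (q.1.1 i)) ∧
      (∀ i, EqOn (q.1.2 i) (p.1.2 i) (p.1.1 i)) ∧ A j ⊆ ⋃ i, interior (q.1.1 i))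
    (by
      intro j p
      obtain ⟨C, g, h1, h2, h3, h4, h5⟩ := stepS a (A j) (hA j) (hD j) p.1.1 p.1.2 p.2.1 p.2.2
      exact ⟨⟨(C, g), h1, h3⟩, h2, h4, h5⟩)
    ⟨(F, f), hF, hf⟩
  have hl := fun i => limit_map (fun j => (s j).1.1 i) (fun j => (s j).1.2 i)
    (fun j => (hs j).1 i) (fun j => (s j).2.2 i) (fun j => (hs j).2.1 i)
  choose hopen G hG hGe using hl
  refine ⟨fun i => ⋃ j, (s j).1.1 i, G, hopen, fun i => ?_, hG, fun i => ?_, ?_⟩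
  · have := subset_iUnion (fun j => (s j).1.1 i) 0
    rw [hs0] at this; exact this
  · have := hGe i 0
    simp only [hs0] at this; exact this
  · rw [eq_univ_iff_forall] at hcov ⊢
    intro x
    obtain ⟨j, hj⟩ := mem_iUnion.1 (hcov x)
    obtain ⟨i, hi⟩ := mem_iUnion.1 ((hs j).2.2 hj)
    exact mem_iUnion.2 ⟨i, mem_iUnion.2 ⟨j + 1, interior_subset hi⟩⟩

theorem D_closedEmbedding [Nonempty L] {X Y : Type} [TopologicalSpace X] [TopologicalSpace Y]
    {k : ℕ} (φ : Y → X) (hφ : IsClosedEmbedding φ) (hD : D L k X) : D L k Y := by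
  intro F f hF hf
  by_cases hY : IsEmpty Y
  · exact ⟨fun _ => ∅, f, fun _ => isOpen_empty, fun i x => (hY.false x).elim,
      fun i x => (hY.false x).elim, fun i x => (hY.false x).elim,
      eq_univ_iff_forall.2 fun x => (hY.false x).elim⟩
  rw [not_isEmpty_iff] at hY
  have hinv : ∀ y, Function.invFun φ (φ y) = y := Function.leftInverse_invFun hφ.injective
  obtain ⟨U, g, hU, hFU, hg, hgf, hcov⟩ := hD (fun i => φ '' F i)
    (fun i x => f i (Function.invFun φ x)) (fun i => hφ.isClosedMap _ (hF i))
    (fun i => by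
      rw [hφ.isEmbedding.isInducing.continuousOn_image_iff]
      exact (hf i).congr (fun y _ => by simp [hinv]))
  refine ⟨fun i => φ ⁻¹' U i, fun i y => g i (φ y), fun i => (hU i).preimage hφ.continuous,
    fun i y hy => hFU i ⟨y, hy, rfl⟩, fun i => (hg i).comp hφ.continuous.continuousOn
      (fun y hy => hy), fun i y hy => ?_, ?_⟩
  · have := hgf i (show φ y ∈ φ '' F i from ⟨y, hy, rfl⟩)
    simpa [hinv] using this
  · rw [← preimage_iUnion, hcov, preimage_univ]

/-- countable sum theorem, for a closed subset -/
theorem sum_thm_sub [Nonempty L] (a : Amb L Q) {X : Type} [MetricSpace X] {k : ℕ}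
    (A : ℕ → Set X) (hA : ∀ j, IsClosed (A j)) (hD : ∀ j, D L k (A j)) (S : Set X)
    (hS : IsClosed S) (hcov : S ⊆ ⋃ j, A j) : D L k S := by
  refine sum_thm a (fun j => (Subtype.val ⁻¹' A j : Set S))
    (fun j => (hA j).preimage continuous_subtype_val) (fun j => ?_) ?_
  · refine D_closedEmbedding (X := A j)
      (fun y : (Subtype.val ⁻¹' A j : Set S) => ⟨y.1.1, y.2⟩) ?_ (hD j)
    have h1 : IsClosedEmbedding (fun y : (Subtype.val ⁻¹' A j : Set S) => (y.1.1 : X)) :=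
      hS.isClosedEmbedding_subtypeVal.comp
        ((hA j).preimage continuous_subtype_val).isClosedEmbedding_subtypeVal
    exact IsClosedEmbedding.of_comp (g := (Subtype.val : A j → X)) IsEmbedding.subtypeVal h1
  · rw [eq_univ_iff_forall]
    intro x
    obtain ⟨j, hj⟩ := mem_iUnion.1 (hcov x.2)
    exact mem_iUnion.2 ⟨j, hj⟩

end basics

section patching

open Metric

variable {L Q : Type} [MetricSpace L] [MetricSpace Q]

theorem near [CompactSpace L] [Nonempty L] (a : Amb L Q) (ε : ℝ) (hε : 0 < ε) :
    ∃ δ > 0, δ ≤ ε ∧ ∀ q, infDist q (range a.e) ≤ δ → q ∈ a.W ∧ dist (a.e (a.r q)) q ≤ ε := by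
  have hc : IsCompact (range a.e) := isCompact_range a.cont_e
  have hco : ContinuousOn (fun q => dist (a.e (a.r q)) q) a.W :=
    continuous_dist.comp_continuousOn ((a.cont_e.comp_continuousOn a.cont_r).prodMk continuousOn_id)
  have hO : IsOpen (a.W ∩ (fun q => dist (a.e (a.r q)) q) ⁻¹' Iio ε) :=
    hco.isOpen_inter_preimage a.openW isOpen_Iio
  obtain ⟨δ, hδ, hsub⟩ := hc.exists_thickening_subset_open hO (by
    rintro _ ⟨x, rfl⟩
    refine ⟨a.e_mem x, ?_⟩
    simp [a.r_e, hε])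
  refine ⟨min (δ / 2) ε, lt_min (by positivity) hε, min_le_right _ _, fun q hq => ?_⟩
  have : q ∈ thickening δ (range a.e) := by
    rw [mem_thickening_iff_infDist_lt (range_nonempty _)]
    have := min_le_left (δ / 2) ε
    linarith
  exact ⟨(hsub this).1, le_of_lt (hsub this).2⟩

theorem infDist_range_le (a : Amb L Q) (q : Q) (x : L) : infDist q (range a.e) ≤ dist q (a.e x) :=
  infDist_le_dist_of_mem ⟨x, rfl⟩

theorem patch [CompactSpace L] [Nonempty L] (a : Amb L Q) : ∃ η > 0, ∀ (X : Type) [MetricSpace X]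
    (F U : Set X) (f w : X → L), IsClosed F → IsOpen U → F ⊆ U → ContinuousOn f F →
    ContinuousOn w U → (∀ x ∈ F, dist (a.e (w x)) (a.e (f x)) < η) →
    ∃ w' : X → L, ContinuousOn w' U ∧ EqOn w' f F := by
  obtain ⟨δ, hδ, -, hδW⟩ := near a 1 one_pos
  refine ⟨δ, hδ, ?_⟩
  intro X _ F U f w hF hU hFU hf hw hd
  obtain ⟨H, hH⟩ := a.tietze X F (fun x => a.e (f x)) hF (a.cont_e.comp_continuousOn hf)
  have hco : ContinuousOn (fun x => dist (H x) (a.e (w x))) U :=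
    continuous_dist.comp_continuousOn
      (H.continuous.continuousOn.prodMk (a.cont_e.comp_continuousOn hw))
  let V := U ∩ (fun x => dist (H x) (a.e (w x))) ⁻¹' Iio δ
  have hV : IsOpen V := hco.isOpen_inter_preimage hU isOpen_Iio
  have hFV : F ⊆ V := fun x hx => ⟨hFU hx, by
    show dist (H x) (a.e (w x)) < δ
    rw [hH hx, dist_comm]; exact hd x hx⟩
  obtain ⟨φ, h0, h1, h01⟩ := exists_continuous_zero_one_of_isClosed hV.isClosed_compl hF
    (disjoint_left.2 fun x hx hx' => hx (hFV hx'))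
  let ψ : X → unitInterval := fun x => ⟨φ x, h01 x⟩
  have hψ : Continuous ψ := φ.continuous.subtype_mk _
  have hcomb : ContinuousOn (fun x => a.comb (ψ x) (H x) (a.e (w x))) U := by
    exact a.cont_comb.comp_continuousOn (hψ.continuousOn.prodMk
      (H.continuous.continuousOn.prodMk (a.cont_e.comp_continuousOn hw)))
  refine ⟨fun x => a.r (a.comb (ψ x) (H x) (a.e (w x))), ?_, ?_⟩
  · refine a.cont_r.comp hcomb fun x hx => ?_
    by_cases hxV : x ∈ V
    · refine (hδW _ ?_).1
      refine (infDist_range_le a _ (w x)).trans ((a.dist_comb _ _ _).trans ?_)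
      exact le_of_lt hxV.2
    · have : ψ x = 0 := Subtype.ext (h0 hxV)
      simp only [this, a.comb_zero]
      exact a.e_mem _
  · intro x hx
    have : ψ x = 1 := Subtype.ext (h1 hx)
    simp only [this, a.comb_one, hH hx, a.r_e]

theorem sol_D [CompactSpace L] [Nonempty L] (a : Amb L Q) : ∃ ε > 0, ∀ (X : Type) [MetricSpace X]
    (k : ℕ), (∀ h : Fin k → C(X, Q), ∃ v : Fin k → C(X, Q), ∀ x,
      (∀ i, h i x ∈ range a.e → dist (v i x) (h i x) ≤ ε) ∧
      ∃ i, infDist (v i x) (range a.e) ≤ ε) → D L k X := by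
  obtain ⟨η, hη, hpatch⟩ := patch a
  obtain ⟨δ, hδ, hδη, hδW⟩ := near a (η / 2) (by positivity)
  have hε1 := min_le_left (δ / 2) (η / 4)
  have hε2 := min_le_right (δ / 2) (η / 4)
  refine ⟨min (δ / 2) (η / 4), by positivity, ?_⟩
  intro X _ k hs F f hF hf
  have := fun i => a.tietze X (F i) (fun x => a.e (f i x)) (hF i)
    (a.cont_e.comp_continuousOn (hf i))
  choose h hh using this
  obtain ⟨v, hv⟩ := hs h
  let U : Fin k → Set X := fun i => {x | infDist (v i x) (range a.e) < δ}
  have hU : ∀ i, IsOpen (U i) := fun i =>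
    isOpen_lt ((continuous_infDist_pt _).comp (v i).continuous) continuous_const
  have hFd : ∀ i, ∀ x ∈ F i, dist (v i x) (a.e (f i x)) ≤ min (δ / 2) (η / 4) := by
    intro i x hx
    have := (hv x).1 i (by rw [hh i hx]; exact ⟨_, rfl⟩)
    rwa [hh i hx] at this
  have hFU : ∀ i, F i ⊆ U i := by
    intro i x hx
    have h1 := hFd i x hx
    have h2 := infDist_range_le a (v i x) (f i x)
    show infDist (v i x) (range a.e) < δ
    linarith
  have hw : ∀ i, ContinuousOn (fun x => a.r (v i x)) (U i) := fun i =>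
    a.cont_r.comp (v i).continuous.continuousOn fun x hx => (hδW _ (le_of_lt hx)).1
  have key := fun i => hpatch X (F i) (U i) (f i) (fun x => a.r (v i x)) (hF i) (hU i) (hFU i)
    (hf i) (hw i) (by
      intro x hx
      have h1 := (hδW _ (le_of_lt (hFU i hx))).2
      have h2 := hFd i x hx
      have h3 := dist_triangle (a.e (a.r (v i x))) (v i x) (a.e (f i x))
      linarith)
  choose g hg hgf using key
  refine ⟨U, g, hU, hFU, hg, hgf, eq_univ_iff_forall.2 fun x => ?_⟩
  obtain ⟨i, hi⟩ := (hv x).2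
  refine mem_iUnion.2 ⟨i, ?_⟩
  show infDist (v i x) (range a.e) < δ
  linarith

theorem step [CompactSpace L] [Nonempty L] (a : Amb L Q) (ε : ℝ) (hε : 0 < ε) :
    ∃ δ > 0, δ ≤ ε ∧ ∀ (X : Type) [MetricSpace X] (m : ℕ), D L (m + 1) X →
    ∀ (A : Set X) (u : X → L), IsClosed A → ContinuousOn u A → ∀ h : Fin m → C(X, Q),
    ∃ (A' : Set X) (u' : X → L) (v : Fin m → C(X, Q)), IsClosed A' ∧ ContinuousOn u' A' ∧
      A ⊆ interior A' ∧ EqOn u' u A ∧ ∀ x ∉ interior A',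
        (∀ i, infDist (h i x) (range a.e) ≤ δ → dist (v i x) (h i x) ≤ ε) ∧
        ∃ i, infDist (v i x) (range a.e) ≤ ε := by
  obtain ⟨δ, hδ, hδε, hδW⟩ := near a ε hε
  refine ⟨δ, hδ, hδε, ?_⟩
  intro X _ m hD A u hA hu h
  let F : Fin (m + 1) → Set X := Fin.cons A fun i => {x | infDist (h i x) (range a.e) ≤ δ}
  let f : Fin (m + 1) → X → L := Fin.cons u fun i x => a.r (h i x)
  have hF : ∀ i, IsClosed (F i) := by
    intro i
    refine Fin.cases hA (fun i => ?_) i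
    exact isClosed_le ((continuous_infDist_pt _).comp (h i).continuous) continuous_const
  have hf : ∀ i, ContinuousOn (f i) (F i) := by
    intro i
    refine Fin.cases hu (fun i => ?_) i
    exact a.cont_r.comp (h i).continuous.continuousOn fun x hx => (hδW _ hx).1
  obtain ⟨U, g, hU, hFU, hg, hgf, hcov⟩ := hD F f hF hf
  obtain ⟨C, hC, hFC, hCU, hCcov⟩ := shrink F U hF hU hFU hcov
  have := fun i : Fin m => a.tietze X (C i.succ) (fun x => a.e (g i.succ x)) (hC i.succ)
    (a.cont_e.comp_continuousOn ((hg i.succ).mono (hCU i.succ)))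
  choose v hv using this
  refine ⟨C 0, g 0, v, hC 0, (hg 0).mono (hCU 0), hFC 0, hgf 0, fun x hx => ⟨fun i hi => ?_, ?_⟩⟩
  · have hxF : x ∈ F i.succ := hi
    rw [hv i (interior_subset (hFC _ hxF))]
    show dist (a.e (g i.succ x)) _ ≤ ε
    rw [hgf i.succ hxF]
    exact (hδW _ hi).2
  · obtain ⟨i, hi⟩ := mem_iUnion.1 (eq_univ_iff_forall.1 hCcov x)
    revert hi
    refine Fin.cases (fun hi => absurd hi hx) (fun i hi => ⟨i, ?_⟩) i
    rw [hv i (interior_subset hi), infDist_zero_of_mem (mem_range_self _)]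
    exact hε.le

end patching

section approximation

open Metric

variable {L Q : Type} [MetricSpace L] [MetricSpace Q]

/-- selection of centres with controlled oscillation -/
theorem approx_select {M : Type} [MetricSpace M] (S : Set M) (f : M → L) (hf : ContinuousOn f S)
    (ε : ℝ) (hε : 0 < ε) :
    ∃ (O : Set M) (s : O → M), IsOpen O ∧ S ⊆ O ∧
      (∀ y : O, ∀ᶠ z in 𝓝 y, dist (f (s y)) (f (s z)) < ε) ∧
      ∀ y : O, (y : M) ∈ S → dist (f (s y)) (f y) < ε := by
  have h1 : ∀ x : M, ∃ r : ℝ, 0 < r ∧ r ≤ 1 ∧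
      (x ∈ S → ∀ y ∈ S, dist y x < 3 * r → dist (f y) (f x) < ε) := by
    intro x
    by_cases hx : x ∈ S
    · obtain ⟨δ, hδ, h⟩ := Metric.continuousOn_iff.1 hf x hx ε hε
      refine ⟨min (δ / 3) 1, by positivity, min_le_right _ _, fun _ y hy hd => h y hy ?_⟩
      have := min_le_left (δ / 3) 1
      linarith
    · exact ⟨1, one_pos, le_rfl, fun h => absurd h hx⟩
  choose r hr0 hr1 hr using h1
  let O : Set M := ⋃ x ∈ S, ball x (r x)
  have hO : IsOpen O := isOpen_biUnion fun _ _ => isOpen_ball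
  have h2 : ∀ y : O, ∃ s ∈ S, dist (y : M) s < r s ∧
      ∀ s' ∈ S, dist (y : M) s' < r s' → r s' < 2 * r s := by
    intro y
    obtain ⟨s₀, hs₀, hy⟩ := mem_iUnion₂.1 y.2
    let R : Set ℝ := r '' {s | s ∈ S ∧ dist (y : M) s < r s}
    have hne : R.Nonempty := ⟨r s₀, s₀, ⟨hs₀, hy⟩, rfl⟩
    have hbd : BddAbove R := ⟨1, by rintro _ ⟨s, -, rfl⟩; exact hr1 s⟩
    have hpos : 0 < sSup R := lt_of_lt_of_le (hr0 s₀) (le_csSup hbd ⟨s₀, ⟨hs₀, hy⟩, rfl⟩)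
    obtain ⟨_, ⟨s, hs, rfl⟩, hlt⟩ := exists_lt_of_lt_csSup hne (half_lt_self hpos)
    refine ⟨s, hs.1, hs.2, fun s' hs' hd => ?_⟩
    have := le_csSup hbd (show r s' ∈ R from ⟨s', ⟨hs', hd⟩, rfl⟩)
    linarith
  choose s hsS hsd hs using h2
  refine ⟨O, s, hO, fun x hx => mem_iUnion₂.2 ⟨x, hx, mem_ball_self (hr0 x)⟩, fun y => ?_,
    fun y hy => ?_⟩
  · have hopen : IsOpen {z : O | dist (z : M) (s y) < r (s y)} :=
      isOpen_lt (by fun_prop) continuous_const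
    filter_upwards [hopen.mem_nhds (hsd y)] with z hz
    refine hr (s z) (hsS z) (s y) (hsS y) ?_
    have h3 := hs z (s y) (hsS y) hz
    have h4 := hsd z
    have h5 := dist_triangle_left (s y) (s z) z
    have hz' : dist (z : M) (s y) < r (s y) := hz
    linarith
  · rw [dist_comm]
    refine hr (s y) (hsS y) y hy ?_
    have := hsd y
    have := hr0 (s y)
    linarith

theorem approx [CompactSpace L] [Nonempty L] (hANR : IsANR L) {M : Type} [MetricSpace M]
    (S : Set M) (f : M → L) (hf : ContinuousOn f S) (η : ℝ) (hη : 0 < η) :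
    ∃ (O : Set M) (g : M → L), IsOpen O ∧ S ⊆ O ∧ ContinuousOn g O ∧
      ∀ x ∈ S, dist (g x) (f x) < η := by
  have hκ := kuratowskiEmbedding.isometry L
  set κ := kuratowskiEmbedding L
  have hκc : IsClosedEmbedding κ := hκ.isClosedEmbedding
  obtain ⟨W, r, hW, hr, hκW, hrκ⟩ := anr_retract hANR κ hκc
  have hc : IsCompact (range κ) := isCompact_range hκ.continuous
  have hco : ContinuousOn (fun q => dist (κ (r q)) q) W :=
    continuous_dist.comp_continuousOn ((hκ.continuous.comp_continuousOn hr).prodMk continuousOn_id)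
  have hO : IsOpen (W ∩ (fun q => dist (κ (r q)) q) ⁻¹' Iio (η / 3)) :=
    hco.isOpen_inter_preimage hW isOpen_Iio
  obtain ⟨δ, hδ, hsub⟩ := hc.exists_thickening_subset_open hO (by
    rintro _ ⟨x, rfl⟩
    refine ⟨hκW x, ?_⟩
    simp [hrκ, hη])
  let ε := min δ (η / 3)
  have hε : 0 < ε := by positivity
  have hε1 : ε ≤ δ := min_le_left _ _
  have hε2 : ε ≤ η / 3 := min_le_right _ _
  obtain ⟨O, s, hOo, hSO, hloc, hs⟩ := approx_select S f hf ε hε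
  obtain ⟨G, hG⟩ := exists_continuous_forall_mem_convex_of_local_const
    (t := fun y : O => ball (κ (f (s y))) ε) (fun y => convex_ball _ _) (fun y => ⟨κ (f (s y)), by
      filter_upwards [hloc y] with z hz
      rw [mem_ball, hκ.dist_eq]; exact hz⟩)
  have hGO : ∀ y, G y ∈ W ∧ dist (κ (r (G y))) (G y) < η / 3 := fun y => by
    have := hsub (mem_thickening_iff.2 ⟨κ (f (s y)), ⟨_, rfl⟩, lt_of_lt_of_le (hG y) hε1⟩)
    exact this
  refine ⟨O, fun x => if h : x ∈ O then r (G ⟨x, h⟩) else Classical.arbitrary L, hOo, hSO, ?_, ?_⟩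
  · rw [continuousOn_iff_continuous_domRestrict]
    have : Continuous fun y : O => r (G y) :=
      hr.comp_continuous G.continuous fun y => (hGO y).1
    convert this using 1
    funext x
    simp [Set.domRestrict]
  · intro x hx
    have hxO := hSO hx
    simp only [hxO, dif_pos]
    have h1 := (hGO ⟨x, hxO⟩).2
    have h2 : dist (G ⟨x, hxO⟩) (κ (f (s ⟨x, hxO⟩))) < ε := hG ⟨x, hxO⟩
    have h3 := hs ⟨x, hxO⟩ hx
    have h4 := dist_triangle4 (κ (r (G ⟨x, hxO⟩))) (G ⟨x, hxO⟩) (κ (f (s ⟨x, hxO⟩))) (κ (f x))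
    rw [hκ.dist_eq, hκ.dist_eq] at h4
    simp only at h3
    linarith

theorem D_open [Nonempty L] (a : Amb L Q) {M : Type} [MetricSpace M] {k : ℕ} (hD : D L k M)
    (G : Set M) (hG : IsOpen G) : D L k G := by
  obtain ⟨A, hA, hAG, hU, -⟩ := hG.exists_iUnion_isClosed
  refine sum_thm a (fun j => (Subtype.val ⁻¹' A j : Set G))
    (fun j => (hA j).preimage continuous_subtype_val) (fun j => ?_) ?_
  · refine D_closedEmbedding (fun y : (Subtype.val ⁻¹' A j : Set G) => (y.1.1 : M)) ?_ hD
    refine ⟨IsEmbedding.subtypeVal.comp IsEmbedding.subtypeVal, ?_⟩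
    have : range (fun y : (Subtype.val ⁻¹' A j : Set G) => (y.1.1 : M)) = A j := by
      ext x
      constructor
      · rintro ⟨y, rfl⟩; exact y.2
      · intro hx; exact ⟨⟨⟨x, hAG j hx⟩, hx⟩, rfl⟩
    rw [this]; exact hA j
  · rw [eq_univ_iff_forall]
    intro x
    have : (x : M) ∈ ⋃ j, A j := by rw [hU]; exact x.2
    obtain ⟨j, hj⟩ := mem_iUnion.1 this
    exact mem_iUnion.2 ⟨j, hj⟩

theorem subset_thm [CompactSpace L] [Nonempty L] (hANR : IsANR L) (a : Amb L Q) {M Y : Type}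
    [MetricSpace M] [MetricSpace Y] {k : ℕ} (hD : D L k M) (ι : Y → M) (hι : IsEmbedding ι) :
    D L k Y := by
  intro F f hF hf
  by_cases hY : IsEmpty Y
  · exact ⟨fun _ => ∅, f, fun _ => isOpen_empty, fun i x => (hY.false x).elim,
      fun i x => (hY.false x).elim, fun i x => (hY.false x).elim,
      eq_univ_iff_forall.2 fun x => (hY.false x).elim⟩
  rw [not_isEmpty_iff] at hY
  have hinv : ∀ y, Function.invFun ι (ι y) = y := Function.leftInverse_invFun hι.injective
  obtain ⟨η, hη, hpatch⟩ := patch a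
  have huc : UniformContinuous a.e := CompactSpace.uniformContinuous_of_continuous a.cont_e
  obtain ⟨η', hη', he⟩ := Metric.uniformContinuous_iff.1 huc η hη
  have h1 := fun i => approx hANR (ι '' F i) (fun x => f i (Function.invFun ι x))
    (by
      rw [hι.isInducing.continuousOn_image_iff]
      exact (hf i).congr (fun y _ => by simp [hinv])) η' hη'
  choose O g hO hFO hg hgd using h1
  let K : Fin k → Set M := fun i => closure (ι '' F i)
  let G : Set M := (⋃ i, K i \ O i)ᶜ
  have hG : IsOpen G :=
    (isClosed_iUnion_of_finite fun i => isClosed_closure.sdiff (hO i)).isOpen_compl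
  have hKG : ∀ i, ∀ x ∈ G, x ∈ K i → x ∈ O i := by
    intro i x hx hxK
    by_contra hxO
    exact hx (mem_iUnion.2 ⟨i, hxK, hxO⟩)
  have hKF : ∀ i y, ι y ∈ K i → y ∈ F i := by
    intro i y hy
    have := hι.isInducing.closure_eq_preimage_closure_image (F i)
    rw [(hF i).closure_eq] at this
    rw [this]; exact hy
  have hιG : ∀ y, ι y ∈ G := by
    intro y hy
    obtain ⟨i, hi, hiO⟩ := mem_iUnion.1 hy
    exact hiO (hFO i ⟨y, hKF i y hi, rfl⟩)
  obtain ⟨U, w, hU, hKU, hw, hwg, hcov⟩ := D_open a hD G hG (fun i => Subtype.val ⁻¹' K i)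
    (fun i x => g i x) (fun i => isClosed_closure.preimage continuous_subtype_val)
    (fun i => (hg i).comp continuous_subtype_val.continuousOn fun x hx => hKG i x x.2 hx)
  let ι' : Y → G := fun y => ⟨ι y, hιG y⟩
  have hι' : Continuous ι' := hι.continuous.subtype_mk _
  have hFK : ∀ i, ∀ y ∈ F i, ι y ∈ K i := fun i y hy => subset_closure ⟨y, hy, rfl⟩
  have key := fun i => hpatch Y (F i) (ι' ⁻¹' U i) (f i) (fun y => w i (ι' y)) (hF i)
    ((hU i).preimage hι') (fun y hy => hKU i (hFK i y hy)) (hf i)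
    ((hw i).comp hι'.continuousOn fun y hy => hy) (by
      intro y hy
      apply he
      rw [hwg i (show ι' y ∈ Subtype.val ⁻¹' K i from hFK i y hy)]
      have := hgd i (ι y) ⟨y, hy, rfl⟩
      rwa [hinv] at this)
  choose w' hw' hwf using key
  refine ⟨fun i => ι' ⁻¹' U i, w', fun i => (hU i).preimage hι', fun i y hy => hKU i (hFK i y hy),
    hw', hwf, ?_⟩
  rw [← preimage_iUnion, hcov, preimage_univ]

end approximation

section hard

open Metric Filter

/-- truncation in `Q × (ℕ → Fin m → Q)` -/
def trunc {Q : Type} {m : ℕ} (j : ℕ) (t : Q × (ℕ → Fin m → Q)) : Q × (ℕ → Fin m → Q) :=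
  (t.1, fun l => if l < j then t.2 l else fun _ => t.1)

theorem continuous_trunc {Q : Type} [TopologicalSpace Q] {m : ℕ} (j : ℕ) :
    Continuous (trunc j : Q × (ℕ → Fin m → Q) → _) := by
  refine continuous_fst.prodMk (continuous_pi fun l => ?_)
  by_cases h : l < j
  · simp only [h, if_true]; fun_prop
  · simp only [h, if_false]; fun_prop

theorem trunc_unif {Q : Type} [MetricSpace Q] [CompactSpace Q] {m : ℕ}
    (q : C(Q × (ℕ → Fin m → Q), Fin m → Q)) (ρ : ℝ) (hρ : 0 < ρ) :
    ∃ N, ∀ j ≥ N, ∀ t, dist (q (trunc j t)) (q t) < ρ := by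
  have huc : UniformContinuous q := CompactSpace.uniformContinuous_of_continuous q.continuous
  have h1 : TendstoUniformly (fun j t => (trunc j t : Q × (ℕ → Fin m → Q))) id atTop := by
    rw [tendstoUniformly_iff_tendsto, uniformity_prod, Pi.uniformity, comap_iInf]
    refine tendsto_inf.2 ⟨?_, tendsto_iInf.2 fun l => ?_⟩
    · rw [tendsto_comap_iff]
      intro s hs
      refine mem_map.2 (univ_mem' fun p => ?_)
      exact refl_mem_uniformity hs
    · rw [tendsto_comap_iff, tendsto_comap_iff]
      intro s hs
      have : ∀ᶠ p : ℕ × (Q × (ℕ → Fin m → Q)) in atTop ×ˢ ⊤, l < p.1 :=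
        tendsto_fst.eventually (eventually_gt_atTop l)
      refine mem_map.2 ?_
      filter_upwards [this] with p hp
      simp only [mem_preimage, Function.comp, trunc, hp, if_true, id]
      exact refl_mem_uniformity hs
  have h2 := Metric.tendstoUniformly_iff.1 (huc.comp_tendstoUniformly h1) ρ hρ
  obtain ⟨N, hN⟩ := eventually_atTop.1 h2
  refine ⟨N, fun j hj t => ?_⟩
  rw [dist_comm]
  exact hN j hj t

theorem hard_thm {L Q : Type} [MetricSpace L] [MetricSpace Q] [CompactSpace L] [Nonempty L]
    [CompactSpace Q] (hANR : IsANR L) (a : Amb L Q) {X : Type} [MetricSpace X]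
    [TopologicalSpace.SeparableSpace X] {m : ℕ} (hD : D L (m + 1) X) (F : Set X) (f : X → L)
    (hF : IsClosed F) (hf : ContinuousOn f F) :
    ∃ (U : Set X) (g : X → L), IsOpen U ∧ F ⊆ U ∧ ContinuousOn g U ∧ EqOn g f F ∧
      D L m (Uᶜ : Set X) := by
  obtain ⟨ε', hε', hsol⟩ := sol_D a
  obtain ⟨ε, hε, hεε⟩ : ∃ ε > 0, 2 * ε = ε' := ⟨ε' / 2, by positivity, by ring⟩
  obtain ⟨δ, hδ, hδε, hstep⟩ := step a ε hε
  obtain ⟨j₀, hj₀⟩ := a.embeds X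
  let q₀ : Q := a.e (Classical.arbitrary L)
  have : Nonempty C(Q × (ℕ → Fin m → Q), Fin m → Q) := ⟨ContinuousMap.const _ fun _ => q₀⟩
  obtain ⟨q, hq⟩ := TopologicalSpace.exists_dense_seq C(Q × (ℕ → Fin m → Q), Fin m → Q)
  let Φ : (ℕ → Fin m → C(X, Q)) → X → Q × (ℕ → Fin m → Q) := fun v x => (j₀ x, fun l i => v l i x)
  have hΦ : ∀ v, Continuous (Φ v) := fun v =>
    hj₀.continuous.prodMk (continuous_pi fun l => continuous_pi fun i => (v l i).continuous)
  let St := {p : (ℕ → Fin m → C(X, Q)) × Set X × (X → L) //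
    IsClosed p.2.1 ∧ ContinuousOn p.2.2 p.2.1}
  obtain ⟨s, hs0, hs⟩ := exists_seq_of_step
    (fun (j : ℕ) (p p' : St) => (∀ l, l ≠ j → p'.1.1 l = p.1.1 l) ∧
      p.1.2.1 ⊆ interior p'.1.2.1 ∧ EqOn p'.1.2.2 p.1.2.2 p.1.2.1 ∧
      ∀ x ∉ interior p'.1.2.1,
        (∀ i, infDist (q (Nat.unpair j).1 (trunc j (Φ p.1.1 x)) i) (range a.e) ≤ δ →
          dist (p'.1.1 j i x) (q (Nat.unpair j).1 (trunc j (Φ p.1.1 x)) i) ≤ ε) ∧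
        ∃ i, infDist (p'.1.1 j i x) (range a.e) ≤ ε)
    (by
      rintro j ⟨⟨v, A, u⟩, hA, hu⟩
      obtain ⟨A', u', w, hA', hu', hAA, hEq, hw⟩ := hstep X m hD A u hA hu
        (fun i => ⟨fun x => q (Nat.unpair j).1 (trunc j (Φ v x)) i,
          (continuous_apply i).comp ((q _).continuous.comp ((continuous_trunc j).comp (hΦ v)))⟩)
      refine ⟨⟨⟨Function.update v j w, A', u'⟩, hA', hu'⟩, ?_, hAA, hEq, ?_⟩
      · intro l hl
        exact Function.update_of_ne hl _ _
      · intro x hx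
        simpa using hw x hx)
    ⟨⟨fun _ _ => ContinuousMap.const _ q₀, F, f⟩, hF, hf⟩
  obtain ⟨hopen, G, hG, hGe⟩ := limit_map (fun j => (s j).1.2.1) (fun j => (s j).1.2.2)
    (fun j => (hs j).2.1) (fun j => (s j).2.2) (fun j => (hs j).2.2.1)
  refine ⟨⋃ j, (s j).1.2.1, G, hopen, ?_, hG, ?_, ?_⟩
  · have := subset_iUnion (fun j => (s j).1.2.1) 0
    rw [hs0] at this; exact this
  · have := hGe 0
    simp only [hs0] at this; exact this
  set P : Set X := (⋃ j, (s j).1.2.1)ᶜ with hP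
  let v : ℕ → Fin m → C(X, Q) := fun l => (s (l + 1)).1.1 l
  have hv : ∀ l j, l < j → (s j).1.1 l = v l := by
    intro l j hlj
    induction j, (show l + 1 ≤ j from hlj) using Nat.le_induction with
    | base => rfl
    | succ k hk ih =>
      rw [(hs k).1 l (by omega)]
      exact ih (by omega)
  have htr : ∀ j x, trunc j (Φ (s j).1.1 x) = trunc j (Φ v x) := by
    intro j x
    refine Prod.ext rfl (funext fun l => ?_)
    by_cases hl : l < j
    · simp only [trunc, Φ, hl, if_true, hv l j hl]
    · simp only [trunc, Φ, hl, if_false]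
  have hemb : IsEmbedding (Φ v) := by
    refine IsEmbedding.of_comp (hΦ v) continuous_fst ?_
    exact hj₀
  -- the closed sets of good points
  let Gd : ℕ → Set (Q × (ℕ → Fin m → Q)) := fun j => {t |
    (∀ i, infDist (q (Nat.unpair j).1 (trunc j t) i) (range a.e) < δ →
      dist (t.2 j i) (q (Nat.unpair j).1 (trunc j t) i) ≤ ε) ∧
    ∃ i, infDist (t.2 j i) (range a.e) ≤ ε}
  have hGd : ∀ j, IsClosed (Gd j) := by
    intro j
    have hc : ∀ i, Continuous fun t : Q × (ℕ → Fin m → Q) =>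
        q (Nat.unpair j).1 (trunc j t) i := fun i =>
      (continuous_apply i).comp ((q _).continuous.comp (continuous_trunc j))
    have hc2 : ∀ i, Continuous fun t : Q × (ℕ → Fin m → Q) => t.2 j i := fun i => by fun_prop
    have : Gd j = (⋂ i, ({t | δ ≤ infDist (q (Nat.unpair j).1 (trunc j t) i) (range a.e)} ∪
        {t | dist (t.2 j i) (q (Nat.unpair j).1 (trunc j t) i) ≤ ε})) ∩
        ⋃ i, {t | infDist (t.2 j i) (range a.e) ≤ ε} := by
      ext t
      simp only [Gd, mem_ofPred_eq, mem_inter_iff, mem_iInter, mem_union, mem_iUnion]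
      refine and_congr (forall_congr' fun i => ?_) Iff.rfl
      rw [imp_iff_not_or, not_lt]
    rw [this]
    refine (isClosed_iInter fun i => ?_).inter (isClosed_iUnion_of_finite fun i => ?_)
    · exact (isClosed_le continuous_const ((continuous_infDist_pt _).comp (hc i))).union
        (isClosed_le ((hc2 i).dist (hc i)) continuous_const)
    · exact isClosed_le ((continuous_infDist_pt _).comp (hc2 i)) continuous_const
  have hPGd : ∀ j, ∀ x ∈ P, Φ v x ∈ Gd j := by
    intro j x hx
    have hx' : x ∉ interior (s (j + 1)).1.2.1 := fun h =>
      hx (mem_iUnion.2 ⟨j + 1, interior_subset h⟩)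
    have h1 := (hs j).2.2.2 x hx'
    rw [htr] at h1
    exact ⟨fun i hi => h1.1 i hi.le, h1.2⟩
  let mT : MetricSpace (Q × (ℕ → Fin m → Q)) := UniformSpace.metricSpace _
  let P' : Set (Q × (ℕ → Fin m → Q)) := closure (Φ v '' P)
  have hP' : ∀ j, P' ⊆ Gd j := fun j => closure_minimal (by
    rintro _ ⟨x, hx, rfl⟩; exact hPGd j x hx) (hGd j)
  have hDP' : D L m P' := by
    refine hsol P' m fun h => ?_
    have h1 : ∀ i, ∃ H : C(Q × (ℕ → Fin m → Q), Q), ∀ t : P', H t = h i t := by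
      intro i
      obtain ⟨H, hH⟩ := a.tietze (Q × (ℕ → Fin m → Q)) P'
        (fun t => if ht : t ∈ P' then h i ⟨t, ht⟩ else q₀) isClosed_closure (by
          rw [continuousOn_iff_continuous_domRestrict]
          refine (h i).continuous.congr fun x => ?_
          simp [Set.domRestrict])
      exact ⟨H, fun t => by rw [hH t.2]; simp⟩
    choose H hH using h1
    let HH : C(Q × (ℕ → Fin m → Q), Fin m → Q) :=
      ⟨fun t i => H i t, continuous_pi fun i => (H i).continuous⟩
    obtain ⟨b, hb⟩ := hq.exists_dist_lt HH (half_pos hδ)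
    obtain ⟨N, hN⟩ := trunc_unif (q b) (δ / 2) (half_pos hδ)
    let j := Nat.pair b N
    have hj1 : (Nat.unpair j).1 = b := by simp [j]
    have hclose : ∀ t i, dist (q (Nat.unpair j).1 (trunc j t) i) (H i t) < δ := by
      intro t i
      rw [hj1]
      have h2 := hN j (Nat.right_le_pair b N) t
      have h3 : dist (HH t) (q b t) < δ / 2 := lt_of_le_of_lt (ContinuousMap.dist_apply_le_dist t) hb
      have h4 := dist_le_pi_dist (q b (trunc j t)) (HH t) i
      have h5 := dist_triangle_right (q b (trunc j t)) (HH t) (q b t)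
      have h6 : HH t i = H i t := rfl
      rw [h6] at h4
      linarith
    refine ⟨fun i => ⟨fun t => t.1.2 j i, by fun_prop⟩, fun t => ⟨fun i hi => ?_, ?_⟩⟩
    · rw [← hH] at hi ⊢
      obtain ⟨y, hy⟩ := hi
      have h2 := hclose t i
      have h3 := infDist_range_le a (q (Nat.unpair j).1 (trunc j t) i) y
      rw [hy] at h3
      have h4 := (hP' j t.2).1 i (lt_of_le_of_lt h3 h2)
      have h5 := dist_triangle (t.1.2 j i) (q (Nat.unpair j).1 (trunc j t) i) (H i t)
      show dist (t.1.2 j i) (H i t) ≤ ε'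
      linarith
    · obtain ⟨i, hi⟩ := (hP' j t.2).2
      exact ⟨i, show infDist (t.1.2 j i) (range a.e) ≤ ε' by linarith⟩
  refine subset_thm hANR a hDP' (fun x : P => ⟨Φ v x, subset_closure ⟨x, x.2, rfl⟩⟩) ?_
  refine IsEmbedding.of_comp ?_ continuous_subtype_val (hemb.comp IsEmbedding.subtypeVal)
  exact ((hΦ v).comp continuous_subtype_val).subtype_mk _

end hard

section final

variable {L Q : Type} [MetricSpace L] [MetricSpace Q]

theorem LIndLE_unfold (L : Type) [TopologicalSpace L] (X : Type) [tX : TopologicalSpace X]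
    (α : Ordinal.{0}) : LIndLE L X α ↔
    ∀ F : Set X, IsClosed F → ∀ f : C(F, L),
      ∃ U : Set X, IsOpen U ∧ ∃ hFU : F ⊆ U,
        (∃ g : C(U, L), ∀ (x : X) (hx : x ∈ F), g ⟨x, hFU hx⟩ = f ⟨x, hx⟩) ∧
        (Uᶜ = (∅ : Set X) ∨ ∃ β : Set.Iio α, LIndLE L (↥(Uᶜ)) β.1) := by
  unfold LIndLE LIndLeAux
  rw [WellFounded.fix_eq]

theorem LIndLE_iff (L : Type) [TopologicalSpace L] [Nonempty L] (X : Type) [TopologicalSpace X]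
    (α : Ordinal.{0}) : LIndLE L X α ↔
    ∀ (F : Set X) (f : X → L), IsClosed F → ContinuousOn f F →
      ∃ (U : Set X) (g : X → L), IsOpen U ∧ F ⊆ U ∧ ContinuousOn g U ∧ EqOn g f F ∧
        (Uᶜ = (∅ : Set X) ∨ ∃ β < α, LIndLE L (↥(Uᶜ)) β) := by
  rw [LIndLE_unfold]
  constructor
  · intro H F f hF hf
    obtain ⟨U, hU, hFU, ⟨g, hg⟩, hP⟩ := H F hF
      ⟨F.domRestrict f, continuousOn_iff_continuous_domRestrict.1 hf⟩
    refine ⟨U, fun x => if h : x ∈ U then g ⟨x, h⟩ else Classical.arbitrary L, hU, hFU, ?_, ?_, ?_⟩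
    · rw [continuousOn_iff_continuous_domRestrict]
      refine g.continuous.congr fun x => ?_
      simp [Set.domRestrict]
    · intro x hx
      simp only [hFU hx, dif_pos]
      exact hg x hx
    · rcases hP with hP | ⟨β, hβ⟩
      · exact Or.inl hP
      · exact Or.inr ⟨β.1, β.2, hβ⟩
  · intro H F hF f
    obtain ⟨U, g, hU, hFU, hg, hgf, hP⟩ := H F
      (fun x => if h : x ∈ F then f ⟨x, h⟩ else Classical.arbitrary L) hF (by
        rw [continuousOn_iff_continuous_domRestrict]
        refine f.continuous.congr fun x => ?_
        simp [Set.domRestrict])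
    refine ⟨U, hU, hFU, ⟨⟨U.domRestrict g, continuousOn_iff_continuous_domRestrict.1 hg⟩, ?_⟩, ?_⟩
    · intro x hx
      have := hgf hx
      simp only [hx, dif_pos] at this
      exact this
    · rcases hP with hP | ⟨β, hβ, h⟩
      · exact Or.inl hP
      · exact Or.inr ⟨⟨β, hβ⟩, h⟩

theorem D_of_isEmpty (L : Type) [TopologicalSpace L] (k : ℕ) (X : Type) [TopologicalSpace X]
    (hX : IsEmpty X) : D L k X := fun F f _ _ =>
  ⟨fun _ => ∅, f, fun _ => isOpen_empty, fun i x => (hX.false x).elim,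
      fun i x => (hX.false x).elim, fun i x => (hX.false x).elim,
      eq_univ_iff_forall.2 fun x => (hX.false x).elim⟩

theorem D_zero (L : Type) [TopologicalSpace L] (X : Type) [TopologicalSpace X]
    (h : D L 0 X) : IsEmpty X := by
  obtain ⟨U, g, -, -, -, -, hcov⟩ := h Fin.elim0 Fin.elim0 (fun i => i.elim0) (fun i => i.elim0)
  refine ⟨fun x => ?_⟩
  obtain ⟨i, -⟩ := mem_iUnion.1 (eq_univ_iff_forall.1 hcov x)
  exact i.elim0

theorem D_cons [Nonempty L] (a : Amb L Q) {X : Type} [MetricSpace X] {k : ℕ}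
    (H : ∀ (F : Set X) (f : X → L), IsClosed F → ContinuousOn f F →
      ∃ (U : Set X) (g : X → L), IsOpen U ∧ F ⊆ U ∧ ContinuousOn g U ∧ EqOn g f F ∧
        D L k (Uᶜ : Set X)) : D L (k + 1) X := by
  intro F f hF hf
  obtain ⟨U, g, hU, hFU, hg, hgf, hD⟩ := H (F 0) (f 0) (hF 0) (hf 0)
  obtain ⟨C, g', hC, hFC, hg', hgf', hcov⟩ := stepS a Uᶜ hU.isClosed_compl hD
    (fun i => F i.succ) (fun i => f i.succ) (fun i => hF i.succ) (fun i => hf i.succ)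
  refine ⟨Fin.cons U fun i => interior (C i), Fin.cons g g', ?_, ?_, ?_, ?_, ?_⟩
  · exact fun i => Fin.cases hU (fun i => isOpen_interior) i
  · exact fun i => Fin.cases hFU (fun i => hFC i) i
  · exact fun i => Fin.cases hg (fun i => (hg' i).mono interior_subset) i
  · exact fun i => Fin.cases hgf (fun i => hgf' i) i
  · rw [eq_univ_iff_forall]
    intro x
    by_cases hx : x ∈ U
    · exact mem_iUnion.2 ⟨0, hx⟩
    · obtain ⟨i, hi⟩ := mem_iUnion.1 (hcov hx)
      exact mem_iUnion.2 ⟨i.succ, hi⟩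

theorem D_mono [Nonempty L] (a : Amb L Q) {X : Type} [MetricSpace X] {k l : ℕ} (hkl : k ≤ l)
    (h : D L k X) : D L l X := by
  induction l, hkl using Nat.le_induction with
  | base => exact h
  | succ l _ ih =>
    refine D_cons a fun F f hF hf => ?_
    obtain ⟨C, g, hC, hFC, hg, hgf⟩ := ane a F f hF hf
    exact ⟨interior C, g, isOpen_interior, hFC, hg.mono interior_subset, hgf,
      D_closedEmbedding Subtype.val isOpen_interior.isClosed_compl.isClosedEmbedding_subtypeVal ih⟩

theorem LIndLE_iff_D [CompactSpace L] [Nonempty L] [CompactSpace Q] (hANR : IsANR L)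
    (a : Amb L Q) (n : ℕ) : ∀ (X : Type) [MetricSpace X] [SecondCountableTopology X],
    LIndLE L X (n : Ordinal.{0}) ↔ D L (n + 1) X := by
  induction n using Nat.strong_induction_on with
  | _ n ih =>
  intro X _ _
  rw [LIndLE_iff]
  constructor
  · intro H
    refine D_cons a fun F f hF hf => ?_
    obtain ⟨U, g, hU, hFU, hg, hgf, hP⟩ := H F f hF hf
    refine ⟨U, g, hU, hFU, hg, hgf, ?_⟩
    rcases hP with hP | ⟨β, hβ, hP⟩
    · exact D_of_isEmpty _ _ _ (isEmpty_coe_sort.2 hP)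
    · obtain ⟨k, rfl⟩ := Ordinal.lt_omega0.1 (hβ.trans (Ordinal.natCast_lt_omega0 n))
      have hk : k < n := by exact_mod_cast hβ
      exact D_mono a hk ((ih k hk _).1 hP)
  · intro hD F f hF hf
    obtain ⟨U, g, hU, hFU, hg, hgf, hP⟩ := hard_thm hANR a hD F f hF hf
    refine ⟨U, g, hU, hFU, hg, hgf, ?_⟩
    cases n with
    | zero => exact Or.inl (isEmpty_coe_sort.1 (D_zero _ _ hP))
    | succ k =>
      exact Or.inr ⟨(k : Ordinal.{0}), by exact_mod_cast Nat.lt_succ_self k,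
        (ih k (Nat.lt_succ_self k) _).2 hP⟩

theorem ofOrdinal_le (α β : Ordinal.{0}) : Dim.ofOrdinal α ≤ Dim.ofOrdinal β ↔ α ≤ β := by
  simp [Dim.ofOrdinal]

theorem LInd_le_iff [CompactSpace L] [Nonempty L] [CompactSpace Q] (hANR : IsANR L)
    (a : Amb L Q) (n : ℕ) (X : Type) [MetricSpace X] [SecondCountableTopology X] :
    LInd L X ≤ Dim.ofOrdinal (n : Ordinal.{0}) ↔ D L (n + 1) X := by
  unfold LInd
  split_ifs with h1 h2
  · refine iff_of_true ?_ (D_of_isEmpty _ _ _ h1)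
    simp [Dim.ofOrdinal, Dim.minusOne]
  · rw [ofOrdinal_le]
    constructor
    · intro hle
      have hmem : LIndLE L X (sInf {α | LIndLE L X α}) :=
        csInf_mem (s := {α : Ordinal.{0} | LIndLE L X α}) h2
      obtain ⟨k, hk⟩ := Ordinal.lt_omega0.1 (hle.trans_lt (Ordinal.natCast_lt_omega0 n))
      rw [hk] at hmem hle
      have hkn : k ≤ n := by exact_mod_cast hle
      exact D_mono a (Nat.succ_le_succ hkn) ((LIndLE_iff_D hANR a k X).1 hmem)
    · intro hD
      exact csInf_le' ((LIndLE_iff_D hANR a n X).2 hD)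
  · refine iff_of_false ?_ fun hD => h2 ⟨_, (LIndLE_iff_D hANR a n X).2 hD⟩
    simp [Dim.ofOrdinal]

theorem le_LInd [CompactSpace L] [Nonempty L] [CompactSpace Q] (hANR : IsANR L)
    (a : Amb L Q) (n : ℕ) (X : Type) [MetricSpace X] [SecondCountableTopology X]
    (h : ¬ D L n X) : Dim.ofOrdinal (n : Ordinal.{0}) ≤ LInd L X := by
  unfold LInd
  split_ifs with h1 h2
  · exact absurd (D_of_isEmpty _ _ _ h1) h
  · rw [ofOrdinal_le]
    by_contra hlt
    rw [not_le] at hlt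
    have hmem : LIndLE L X (sInf {α | LIndLE L X α}) :=
      csInf_mem (s := {α : Ordinal.{0} | LIndLE L X α}) h2
    obtain ⟨k, hk⟩ := Ordinal.lt_omega0.1 (hlt.trans (Ordinal.natCast_lt_omega0 n))
    rw [hk] at hmem hlt
    have hkn : k < n := by exact_mod_cast hlt
    exact h (D_mono a hkn ((LIndLE_iff_D hANR a k X).1 hmem))
  · exact le_top

theorem LIndPlus_eq_iff [CompactSpace L] [Nonempty L] [CompactSpace Q] (hANR : IsANR L)
    (a : Amb L Q) (n : ℕ) (X : Type) [MetricSpace X] [SecondCountableTopology X]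
    (hD : D L (n + 1) X) (b : X) :
    LIndPlus L b = Dim.ofOrdinal (n : Ordinal.{0}) ↔
      ∀ U : Set X, IsOpen U → b ∈ U → ¬ D L n (closure U) := by
  have hcl : ∀ U : Set X, D L (n + 1) (closure U) := fun U =>
    D_closedEmbedding Subtype.val isClosed_closure.isClosedEmbedding_subtypeVal hD
  constructor
  · intro h U hU hb hDU
    cases n with
    | zero => exact (D_zero _ _ hDU).false ⟨b, subset_closure hb⟩
    | succ k =>
      have h1 : LIndPlus L b ≤ Dim.ofOrdinal (k : Ordinal.{0}) :=
        sInf_le ⟨U, hU, hb, (LInd_le_iff hANR a k _).2 hDU⟩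
      rw [h, ofOrdinal_le] at h1
      have : k + 1 ≤ k := by exact_mod_cast h1
      omega
  · intro h
    apply le_antisymm
    · exact sInf_le ⟨Set.univ, isOpen_univ, mem_univ b, (LInd_le_iff hANR a n _).2 (hcl _)⟩
    · refine le_sInf ?_
      rintro d ⟨U, hU, hb, hd⟩
      exact (le_LInd hANR a n _ (h U hU hb)).trans hd

theorem sum_local [Nonempty L] (a : Amb L Q) {X : Type} [MetricSpace X]
    [SecondCountableTopology X] {k : ℕ} (S B : Set X) (hS : IsClosed S) (hB : IsClosed B)
    (hDB : D L k B) (hloc : ∀ x ∈ S \ B, ∃ U, IsOpen U ∧ x ∈ U ∧ D L k (closure U)) :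
    D L k S := by
  choose! U hU hxU hDU using hloc
  obtain ⟨t, htS, htc, hcov⟩ := TopologicalSpace.countable_cover_nhdsWithin (f := U) (s := S \ B)
    (fun x hx => mem_nhdsWithin_of_mem_nhds ((hU x hx).mem_nhds (hxU x hx)))
  obtain ⟨A, hA⟩ := (((htc.image fun x => closure (U x)).insert B)).exists_eq_range
    (insert_nonempty _ _)
  have hAm : ∀ j, A j = B ∨ ∃ x ∈ t, closure (U x) = A j := fun j => by
    have : A j ∈ insert B ((fun x => closure (U x)) '' t) := by rw [hA]; exact ⟨j, rfl⟩
    exact this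
  refine sum_thm_sub a A (fun j => ?_) (fun j => ?_) S hS ?_
  · rcases hAm j with h | ⟨x, -, h⟩
    · rw [h]; exact hB
    · rw [← h]; exact isClosed_closure
  · rcases hAm j with h | ⟨x, hx, h⟩
    · rw [h]; exact hDB
    · rw [← h]; exact hDU x (htS hx)
  · intro x hx
    have : ∃ Z ∈ insert B ((fun x => closure (U x)) '' t), x ∈ Z := by
      by_cases hxB : x ∈ B
      · exact ⟨B, mem_insert _ _, hxB⟩
      · obtain ⟨y, hy, hxy⟩ := mem_iUnion₂.1 (hcov ⟨hx, hxB⟩)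
        exact ⟨closure (U y), mem_insert_of_mem _ ⟨y, hy, rfl⟩, subset_closure hxy⟩
    rw [hA] at this
    obtain ⟨_, ⟨j, rfl⟩, hj⟩ := this
    exact mem_iUnion.2 ⟨j, hj⟩

theorem not_LIndLE_of_isEmpty (L : Type) [TopologicalSpace L] [IsEmpty L] (α : Ordinal.{0}) :
    ∀ (X : Type) [TopologicalSpace X] [Nonempty X], ¬ LIndLE L X α := by
  induction α using WellFoundedLT.induction with
  | _ α ih =>
  intro X _ _ h
  rw [LIndLE_unfold] at h
  obtain ⟨U, hU, -, ⟨g, -⟩, hP⟩ := h ∅ isClosed_empty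
    ⟨fun x => x.2.elim, continuous_of_const fun x => x.2.elim⟩
  have hU0 : U = ∅ := eq_empty_of_forall_notMem fun x hx => isEmptyElim (g ⟨x, hx⟩)
  subst hU0
  rcases hP with hP | ⟨β, hβ⟩
  · simp at hP
  · have : Nonempty ↥((∅ : Set X)ᶜ) := by simp
    exact ih β.1 β.2 _ hβ

theorem main (L : Type) [MetricSpace L] [CompactSpace L] (hANR : IsANR L)
    (X : Type) [MetricSpace X] [TopologicalSpace.SeparableSpace X]
    (n : ℕ) (h : LInd L X = Dim.ofOrdinal ((n : ℕ) : Ordinal.{0})) :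
    (LKset L X).Nonempty ∧
      ∀ (b : X) (hb : b ∈ LKset L X),
        LIndPlus L (⟨b, hb⟩ : ↥(LKset L X)) = Dim.ofOrdinal ((n : ℕ) : Ordinal.{0}) := by
  have hX2 : SecondCountableTopology X := UniformSpace.secondCountable_of_separable X
  rcases isEmpty_or_nonempty L with hL | hL
  · exfalso
    unfold LInd at h
    split_ifs at h with h1 h2
    · simp [Dim.ofOrdinal, Dim.minusOne] at h
    · rw [not_isEmpty_iff] at h1
      obtain ⟨α, hα⟩ := h2
      exact not_LIndLE_of_isEmpty L α X hα
    · simp [Dim.ofOrdinal] at h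
  obtain ⟨Q, mQ, cQ, ⟨a⟩⟩ := exists_amb L hANR
  have hD : D L (n + 1) X := (LInd_le_iff hANR a n X).1 h.le
  have hnD : ¬ D L n X := by
    intro hDn
    cases n with
    | zero =>
      have := D_zero _ _ hDn
      unfold LInd at h
      rw [if_pos this] at h
      exact WithBot.bot_ne_coe (WithTop.coe_injective h)
    | succ k =>
      have h1 := (LInd_le_iff hANR a k X).2 hDn
      rw [h, ofOrdinal_le] at h1
      have : k + 1 ≤ k := by exact_mod_cast h1
      omega
  have hK : ∀ b : X, b ∈ LKset L X ↔ ∀ U : Set X, IsOpen U → b ∈ U → ¬ D L n (closure U) := by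
    intro b
    rw [← LIndPlus_eq_iff hANR a n X hD b, ← h]
    rfl
  have hKc : ∀ b : X, b ∉ LKset L X → ∃ U : Set X, IsOpen U ∧ b ∈ U ∧ D L n (closure U) := by
    intro b hb
    rw [hK] at hb
    push Not at hb
    exact hb
  have hKcl : IsClosed (LKset L X) := by
    rw [← isOpen_compl_iff, isOpen_iff_mem_nhds]
    intro x hx
    obtain ⟨U, hU, hxU, hDU⟩ := hKc x hx
    refine Filter.mem_of_superset (hU.mem_nhds hxU) fun y hy hyK => ?_
    exact (hK y).1 hyK U hU hy hDU
  constructor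
  · by_contra hne
    rw [not_nonempty_iff_eq_empty] at hne
    apply hnD
    have h1 : D L n (Set.univ : Set X) := sum_local a Set.univ ∅ isClosed_univ isClosed_empty
      (D_of_isEmpty _ _ _ (isEmpty_coe_sort.2 rfl)) fun x _ => hKc x (by rw [hne]; exact id)
    exact D_closedEmbedding _ (Homeomorph.Set.univ X).symm.isClosedEmbedding h1
  · intro b hb
    have hDK : D L (n + 1) (LKset L X) :=
      D_closedEmbedding Subtype.val hKcl.isClosedEmbedding_subtypeVal hD
    rw [LIndPlus_eq_iff hANR a n _ hDK]
    intro U' hU' hbU' hDU'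
    obtain ⟨O, hO, rfl⟩ := isOpen_induced_iff.1 hU'
    obtain ⟨V, hV, hbV, hVO⟩ := normal_exists_closure_subset (isClosed_singleton (x := b)) hO
      (singleton_subset_iff.2 hbU')
    have hbV' : b ∈ V := singleton_subset_iff.1 hbV
    refine (hK b).1 hb V hV hbV' ?_
    have hBc : IsClosed (closure V ∩ LKset L X) := isClosed_closure.inter hKcl
    refine sum_local a (closure V) (closure V ∩ LKset L X) isClosed_closure hBc ?_ fun x hx => ?_
    · refine D_closedEmbedding (fun y : ↥(closure V ∩ LKset L X) =>
        (⟨⟨y.1, y.2.2⟩, subset_closure (hVO y.2.1)⟩ :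
          closure (Subtype.val ⁻¹' O : Set (LKset L X)))) ?_ hDU'
      exact IsClosedEmbedding.of_comp
        (g := fun z : closure (Subtype.val ⁻¹' O : Set (LKset L X)) => (z.1.1 : X))
        (IsEmbedding.subtypeVal.comp IsEmbedding.subtypeVal) hBc.isClosedEmbedding_subtypeVal
    · exact hKc x fun hxK => hx.2 ⟨hx.1, hxK⟩

end final

end LDimProof

-- STATEMENT 13
theorem statement13 (L : Type) [MetricSpace L] [CompactSpace L]
    (hANR : IsANR L) (hL : ¬ContractibleSpace L)
    (X : Type) [MetricSpace X] [TopologicalSpace.SeparableSpace X]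
    (n : ℕ) (h : LInd L X = Dim.ofOrdinal ((n : ℕ) : Ordinal.{0})) :
    (LKset L X).Nonempty ∧
      ∀ (b : X) (hb : b ∈ LKset L X),
        LIndPlus L (⟨b, hb⟩ : ↥(LKset L X)) = Dim.ofOrdinal ((n : ℕ) : Ordinal.{0}) := by
  exact LDimProof.main L hANR X n h

end
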